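/- arXiv:math/0512312 — 9 statements merged into one kernel-verified Lean document; each statement's English description precedes it below -/
import Mathlib

section
/- For every prime p and every integer n ≥ 1, the matrices A(n) and B(n) are inverse of each other, i.e. A(n)·B(n) is the n×n identity matrix. (This is the combinatorial form of the paper's main theorem: combined with the Premet–Suprunenko decomposition of Weyl modules, it gives ch L(ω_r) = Σ_{(r-j)/2 ≺₁ m+1-r} ch Δ(ω_j) − Σ_{(r-j)/2 ≺₋₁ m+1-r} ch Δ(ω_j) for Sp(2m).) -/
open scoped Classical

/-- The `i`-th digit of `a` in base `p`. -/
def pDigit (p a i : ℕ) : ℕ := a / p ^ i % p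

/-- `a ⊂ b` : each nonzero base-`p` digit of `a` agrees with the corresponding digit of `b`. -/
def PSub (p a b : ℕ) : Prop := ∀ i, pDigit p a i = 0 ∨ pDigit p a i = pDigit p b i

/-- `a ≺₁ b` : with `s` the `p`-adic valuation of `b`, the digits of `a` vanish up to `s`
and `a_i + b_i < p` above `s`. -/
def PrecOne (p a b : ℕ) : Prop :=
  (∀ i ≤ padicValNat p b, pDigit p a i = 0) ∧
  (∀ i, padicValNat p b < i → pDigit p a i + pDigit p b i < p)

/-- `a ≺₋₁ b` : with `s` the `p`-adic valuation of `b`, the digits of `a` vanish below `s`,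
`a_s + b_s = p`, and `a_i + b_i < p` above `s`. -/
def PrecNegOne (p a b : ℕ) : Prop :=
  (∀ i < padicValNat p b, pDigit p a i = 0) ∧
  pDigit p a (padicValNat p b) + pDigit p b (padicValNat p b) = p ∧
  (∀ i, padicValNat p b < i → pDigit p a i + pDigit p b i < p)

/-- The matrix `A(n)`, with rows and columns `k, l ∈ {1, …, n}` realized as `i + 1, j + 1`
for `i j : Fin n` : `A(n)_{k,l} = ±1` if `(k-l)/2 ≺±₁ n+1-k` (and `k - l` nonnegative even),
`0` otherwise. -/
noncomputable def matA (p n : ℕ) : Matrix (Fin n) (Fin n) ℤ := fun i j =>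
  if (j : ℕ) ≤ (i : ℕ) ∧ ((i : ℕ) - (j : ℕ)) % 2 = 0 ∧
      PrecOne p (((i : ℕ) - (j : ℕ)) / 2) (n - (i : ℕ)) then 1
  else if (j : ℕ) ≤ (i : ℕ) ∧ ((i : ℕ) - (j : ℕ)) % 2 = 0 ∧
      PrecNegOne p (((i : ℕ) - (j : ℕ)) / 2) (n - (i : ℕ)) then -1
  else 0

/-- The matrix `B(n)` : `B(n)_{k,l} = 1` if `k - l` is nonnegative even and
`(k-l)/2 ⊂ n+1-l`, `0` otherwise. -/
noncomputable def matB (p n : ℕ) : Matrix (Fin n) (Fin n) ℤ := fun i j =>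
  if (j : ℕ) ≤ (i : ℕ) ∧ ((i : ℕ) - (j : ℕ)) % 2 = 0 ∧
      PSub p (((i : ℕ) - (j : ℕ)) / 2) (n - (j : ℕ)) then 1
  else 0

/-- No carry occurs when adding `a` and `b` in base `p`. -/
def NoCarry (p a b : ℕ) : Prop := ∀ i, pDigit p a i + pDigit p b i < p

/-- The signed relation `≺₁` minus `≺₋₁`, extended by zero to `b = 0`. -/
noncomputable def precSign (p a b : ℕ) : ℤ :=
  if b = 0 then 0 else if PrecOne p a b then 1 else if PrecNegOne p a b then -1 else 0

section Digits

variable {p : ℕ} {a₀ b₀ : ℕ}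

theorem pDigit_mul_add_zero (ha : a₀ < p) (a : ℕ) : pDigit p (p * a + a₀) 0 = a₀ := by
  simp [pDigit, Nat.mod_eq_of_lt ha]

theorem pDigit_mul_add_succ (ha : a₀ < p) (a i : ℕ) :
    pDigit p (p * a + a₀) (i + 1) = pDigit p a i := by
  have hp : 0 < p := by omega
  rw [pDigit, pDigit, pow_succ', ← Nat.div_div_eq_div_mul, Nat.mul_add_div hp,
    Nat.div_eq_of_lt ha, add_zero]

theorem noCarry_mul_add (ha : a₀ < p) (hb : b₀ < p) (a b : ℕ) :
    NoCarry p (p * a + a₀) (p * b + b₀) ↔ a₀ + b₀ < p ∧ NoCarry p a b := by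
  constructor
  · intro h
    refine ⟨by simpa only [pDigit_mul_add_zero ha, pDigit_mul_add_zero hb] using h 0, fun i => ?_⟩
    simpa only [pDigit_mul_add_succ ha, pDigit_mul_add_succ hb] using h (i + 1)
  · rintro ⟨h₀, h⟩ (_ | i)
    · simpa only [pDigit_mul_add_zero ha, pDigit_mul_add_zero hb] using h₀
    · simpa only [pDigit_mul_add_succ ha, pDigit_mul_add_succ hb] using h i

theorem pSub_mul_add (ha : a₀ < p) (hb : b₀ < p) (a b : ℕ) :
    PSub p (p * a + a₀) (p * b + b₀) ↔ (a₀ = 0 ∨ a₀ = b₀) ∧ PSub p a b := by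
  constructor
  · intro h
    refine ⟨by simpa only [pDigit_mul_add_zero ha, pDigit_mul_add_zero hb] using h 0, fun i => ?_⟩
    simpa only [pDigit_mul_add_succ ha, pDigit_mul_add_succ hb] using h (i + 1)
  · rintro ⟨h₀, h⟩ (_ | i)
    · simpa only [pDigit_mul_add_zero ha, pDigit_mul_add_zero hb] using h₀
    · simpa only [pDigit_mul_add_succ ha, pDigit_mul_add_succ hb] using h i

theorem padicValNat_mul_add_of_ne_zero (hb : b₀ < p) (h₀ : b₀ ≠ 0) (b : ℕ) :
    padicValNat p (p * b + b₀) = 0 := by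
  apply padicValNat.eq_zero_of_not_dvd
  rw [Nat.dvd_add_right (dvd_mul_right p b)]
  exact Nat.not_dvd_of_pos_of_lt (by omega) hb

theorem padicValNat_mul_self (hp : p.Prime) {b : ℕ} (hb : b ≠ 0) :
    padicValNat p (p * b) = padicValNat p b + 1 := by
  have := Fact.mk hp
  rw [padicValNat.mul hp.ne_zero hb, padicValNat_self, add_comm]

theorem precOne_mul_add_of_ne_zero (ha : a₀ < p) (hb : b₀ < p) (h₀ : b₀ ≠ 0) (a b : ℕ) :
    PrecOne p (p * a + a₀) (p * b + b₀) ↔ a₀ = 0 ∧ NoCarry p a b := by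
  rw [PrecOne, padicValNat_mul_add_of_ne_zero hb h₀]
  constructor
  · rintro ⟨h, h'⟩
    refine ⟨by simpa only [pDigit_mul_add_zero ha] using h 0 le_rfl, fun i => ?_⟩
    simpa only [pDigit_mul_add_succ ha, pDigit_mul_add_succ hb] using h' (i + 1) i.succ_pos
  · rintro ⟨h, h'⟩
    refine ⟨fun i hi => ?_, fun i hi => ?_⟩
    · obtain rfl : i = 0 := by omega
      simpa only [pDigit_mul_add_zero ha] using h
    · obtain ⟨i, rfl⟩ : ∃ j, i = j + 1 := ⟨i - 1, by omega⟩
      simpa only [pDigit_mul_add_succ ha, pDigit_mul_add_succ hb] using h' i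

theorem precNegOne_mul_add_of_ne_zero (ha : a₀ < p) (hb : b₀ < p) (h₀ : b₀ ≠ 0) (a b : ℕ) :
    PrecNegOne p (p * a + a₀) (p * b + b₀) ↔ a₀ + b₀ = p ∧ NoCarry p a b := by
  rw [PrecNegOne, padicValNat_mul_add_of_ne_zero hb h₀]
  constructor
  · rintro ⟨-, h, h'⟩
    refine ⟨by simpa only [pDigit_mul_add_zero ha, pDigit_mul_add_zero hb] using h, fun i => ?_⟩
    simpa only [pDigit_mul_add_succ ha, pDigit_mul_add_succ hb] using h' (i + 1) i.succ_pos
  · rintro ⟨h, h'⟩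
    refine ⟨fun i hi => absurd hi i.not_lt_zero, ?_, fun i hi => ?_⟩
    · simpa only [pDigit_mul_add_zero ha, pDigit_mul_add_zero hb] using h
    · obtain ⟨i, rfl⟩ : ∃ j, i = j + 1 := ⟨i - 1, by omega⟩
      simpa only [pDigit_mul_add_succ ha, pDigit_mul_add_succ hb] using h' i

theorem precOne_mul_add_mul (hp : p.Prime) (ha : a₀ < p) (a : ℕ) {b : ℕ} (hb : b ≠ 0) :
    PrecOne p (p * a + a₀) (p * b + 0) ↔ a₀ = 0 ∧ PrecOne p a b := by
  rw [PrecOne, PrecOne, add_zero, padicValNat_mul_self hp hb, ← add_zero (p * b)]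
  constructor
  · rintro ⟨h, h'⟩
    refine ⟨by simpa only [pDigit_mul_add_zero ha] using h 0 (Nat.zero_le _),
      fun i hi => ?_, fun i hi => ?_⟩
    · simpa only [pDigit_mul_add_succ ha] using h (i + 1) (by omega)
    · simpa only [pDigit_mul_add_succ ha, pDigit_mul_add_succ hp.pos] using h' (i + 1) (by omega)
  · rintro ⟨h₀, h, h'⟩
    refine ⟨fun i hi => ?_, fun i hi => ?_⟩
    · rcases i with _ | i
      · simpa only [pDigit_mul_add_zero ha] using h₀
      · simpa only [pDigit_mul_add_succ ha] using h i (by omega)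
    · obtain ⟨i, rfl⟩ : ∃ j, i = j + 1 := ⟨i - 1, by omega⟩
      simpa only [pDigit_mul_add_succ ha, pDigit_mul_add_succ hp.pos] using h' i (by omega)

theorem precNegOne_mul_add_mul (hp : p.Prime) (ha : a₀ < p) (a : ℕ) {b : ℕ} (hb : b ≠ 0) :
    PrecNegOne p (p * a + a₀) (p * b + 0) ↔ a₀ = 0 ∧ PrecNegOne p a b := by
  rw [PrecNegOne, PrecNegOne, add_zero, padicValNat_mul_self hp hb, ← add_zero (p * b),
    pDigit_mul_add_succ ha, pDigit_mul_add_succ hp.pos]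
  constructor
  · rintro ⟨h, h₁, h'⟩
    refine ⟨by simpa only [pDigit_mul_add_zero ha] using h 0 (Nat.succ_pos _),
      fun i hi => ?_, h₁, fun i hi => ?_⟩
    · simpa only [pDigit_mul_add_succ ha] using h (i + 1) (by omega)
    · simpa only [pDigit_mul_add_succ ha, pDigit_mul_add_succ hp.pos] using h' (i + 1) (by omega)
  · rintro ⟨h₀, h, h₁, h'⟩
    refine ⟨fun i hi => ?_, h₁, fun i hi => ?_⟩
    · rcases i with _ | i
      · simpa only [pDigit_mul_add_zero ha] using h₀
      · simpa only [pDigit_mul_add_succ ha] using h i (by omega)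
    · obtain ⟨i, rfl⟩ : ∃ j, i = j + 1 := ⟨i - 1, by omega⟩
      simpa only [pDigit_mul_add_succ ha, pDigit_mul_add_succ hp.pos] using h' i (by omega)

theorem precSign_mul_add_mul (hp : p.Prime) (ha : a₀ < p) (a b : ℕ) :
    precSign p (p * a + a₀) (p * b + 0) = if a₀ = 0 then precSign p a b else 0 := by
  rcases eq_or_ne b 0 with rfl | hb
  · simp [precSign]
  · have : p * b + 0 ≠ 0 := by simp [hp.ne_zero, hb]
    simp only [precSign, this, hb, if_false, precOne_mul_add_mul hp ha a hb,
      precNegOne_mul_add_mul hp ha a hb]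
    split_ifs <;> simp_all

theorem precSign_mul_add_of_ne_zero (ha : a₀ < p) (hb : b₀ < p) (h₀ : b₀ ≠ 0) (a b : ℕ) :
    precSign p (p * a + a₀) (p * b + b₀) =
      if NoCarry p a b then (if a₀ = 0 then 1 else if a₀ + b₀ = p then -1 else 0) else 0 := by
  have : p * b + b₀ ≠ 0 := by omega
  simp only [precSign, this, if_false, precOne_mul_add_of_ne_zero ha hb h₀ a,
    precNegOne_mul_add_of_ne_zero ha hb h₀ a]
  split_ifs <;> simp_all

theorem mul_add_eq_mul_add_iff {w z r z₀ : ℕ} (hr : r < p) (hz : z₀ < p) :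
    p * w + r = p * z + z₀ ↔ w = z ∧ r = z₀ := by
  constructor
  · intro h
    have h₁ := congrArg (· / p) h
    have h₂ := congrArg (· % p) h
    have hp : 0 < p := by omega
    simp only [Nat.mul_add_div hp, Nat.div_eq_of_lt hr, Nat.div_eq_of_lt hz, add_zero] at h₁
    simp only [Nat.mul_add_mod, Nat.mod_eq_of_lt hr, Nat.mod_eq_of_lt hz] at h₂
    exact ⟨h₁, h₂⟩
  · rintro ⟨rfl, rfl⟩; rfl

theorem mul_add_eq_mul_add_iff_of_lt_two_mul {w z r z₀ : ℕ} (hr : r < 2 * p) (hz : z₀ < p) :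
    p * w + r = p * z + z₀ ↔ (w = z ∧ r = z₀) ∨ (w + 1 = z ∧ r = z₀ + p) := by
  rcases lt_or_ge r p with h | h
  · rw [mul_add_eq_mul_add_iff h hz]
    omega
  · obtain ⟨r, rfl⟩ := Nat.exists_eq_add_of_le h
    rw [show p * w + (p + r) = p * (w + 1) + r by ring, mul_add_eq_mul_add_iff (by omega) hz]
    omega

end Digits

section Sums

open Finset

theorem sum_range_mul_digit {M : Type*} [AddCommMonoid M] (p m : ℕ) (f : ℕ → M) :
    ∑ a ∈ range (p * m), f a = ∑ a ∈ range m, ∑ a₀ ∈ range p, f (p * a + a₀) := by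
  induction m with
  | zero => simp
  | succ m ih => rw [sum_range_succ, ← ih, mul_add, mul_one, sum_range_add]

theorem sum_sum_sum_sum_mul {R : Type*} [CommSemiring R] (m p : ℕ) (u v : ℕ → ℕ → R) :
    ∑ a ∈ range m, ∑ a₀ ∈ range p, ∑ b ∈ range m, ∑ b₀ ∈ range p, u a b * v a₀ b₀ =
      (∑ a ∈ range m, ∑ b ∈ range m, u a b) * ∑ a₀ ∈ range p, ∑ b₀ ∈ range p, v a₀ b₀ := by
  rw [sum_mul_sum]
  refine sum_congr rfl fun a _ => sum_congr rfl fun a₀ _ => ?_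
  rw [sum_mul_sum]

variable {K : Type*} [Field K]

/-- The sum of `t ^ d` over the orbit of `d` under sign change. -/
noncomputable def signSum (t : K) (d : ℕ) : K := if d = 0 then 1 else t ^ d + t⁻¹ ^ d

/-- The quantum integer `(t ^ w - t⁻¹ ^ w) / (t - t⁻¹)`. -/
noncomputable def quantumNat (t : K) (w : ℕ) : K := (t ^ w - t⁻¹ ^ w) / (t - t⁻¹)

/-- The sum of `t ^ (b - 2 * a)` over all `a < p ^ k` with `a ⊂ b`. -/
noncomputable def supportSum (p k : ℕ) (t : K) (b : ℕ) : K :=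
  ∑ a ∈ range (p ^ k), if PSub p a b then t ^ ((b : ℤ) - 2 * a) else 0

theorem supportSum_succ {p b₀ : ℕ} (k : ℕ) {t : K} (ht : t ≠ 0) (hb : b₀ < p) (b : ℕ) :
    supportSum p (k + 1) t (p * b + b₀) = signSum t b₀ * supportSum p k (t ^ p) b := by
  have key : ∑ a₀ ∈ range p, (if a₀ = 0 ∨ a₀ = b₀ then t ^ ((b₀ : ℤ) - 2 * a₀) else 0) =
      signSum t b₀ := by
    rw [← sum_filter]
    rcases eq_or_ne b₀ 0 with rfl | h
    · have : (range p).filter (fun a₀ => a₀ = 0 ∨ a₀ = 0) = {0} := by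
        ext x; simp only [mem_filter, mem_range, mem_singleton]; omega
      rw [this, sum_singleton]
      simp [signSum]
    · have : (range p).filter (fun a₀ => a₀ = 0 ∨ a₀ = b₀) = {0, b₀} := by
        ext x; simp only [mem_filter, mem_range, mem_insert, mem_singleton]; omega
      rw [this, sum_pair (Ne.symm h), signSum, if_neg h]
      congr 1
      · simp
      · rw [inv_pow, ← zpow_natCast, ← zpow_neg]
        congr 1
        ring
  rw [supportSum, pow_succ', sum_range_mul_digit, ← key, supportSum,
    mul_comm (∑ a₀ ∈ range p, _), sum_mul_sum]
  refine sum_congr rfl fun a _ => sum_congr rfl fun a₀ ha => ?_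
  rw [mem_range] at ha
  simp only [pSub_mul_add ha hb]
  by_cases h₁ : a₀ = 0 ∨ a₀ = b₀
  · by_cases h₂ : PSub p a b
    · simp only [h₁, h₂, and_self, if_true]
      rw [← zpow_natCast t p, ← zpow_mul, ← zpow_add₀ ht]
      congr 1
      push_cast
      ring
    · simp [h₂]
  · simp [h₁]

theorem sum_signSum {t : K} (ht : t ≠ 0) (ht' : t - t⁻¹ ≠ 0) (w : ℕ) :
    ∑ a ∈ range ((w + 1) / 2), signSum t (w - 1 - 2 * a) = quantumNat t w := by
  induction w using Nat.twoStepInduction with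
  | zero => simp [quantumNat]
  | one => simp [quantumNat, signSum, ht']
  | more w ih _ =>
    rw [show (w + 2 + 1) / 2 = (w + 1) / 2 + 1 by omega, sum_range_succ']
    have : ∀ a, signSum t (w + 2 - 1 - 2 * (a + 1)) = signSum t (w - 1 - 2 * a) := fun a => by
      congr 1; omega
    simp only [this, ih]
    rw [signSum, if_neg (by omega), quantumNat, quantumNat, show w + 2 - 1 - 2 * 0 = w + 1 by omega]
    rw [eq_div_iff ht', add_mul, div_mul_cancel₀ _ ht']
    simp only [inv_pow]
    field_simp
    ring

/-- The sum of `supportSum` over all `b` with `b + 2 * a + 1 = w` for some `a` without carry. -/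
noncomputable def noCarrySum (p k : ℕ) (t : K) (w : ℕ) : K :=
  ∑ a ∈ range (p ^ k), ∑ b ∈ range (p ^ k),
    if b + 2 * a + 1 = w ∧ NoCarry p a b then supportSum p k t b else 0

theorem sum_digit_signSum_of_lt {p w : ℕ} {t : K} (ht : t ≠ 0) (ht' : t - t⁻¹ ≠ 0) (hw : w < p) :
    ∑ a ∈ range p, ∑ b ∈ range p, (if b + 2 * a = w ∧ a + b < p then signSum t b else 0) =
      quantumNat t (w + 1) := by
  rw [← sum_signSum ht ht']
  have h : ∀ a ∈ range p, ∑ b ∈ range p,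
      (if b + 2 * a = w ∧ a + b < p then signSum t b else 0) =
        if a < (w + 1 + 1) / 2 then signSum t (w + 1 - 1 - 2 * a) else 0 := by
    intro a ha
    split_ifs with h
    · rw [sum_eq_single_of_mem (w + 1 - 1 - 2 * a) (by rw [mem_range]; omega)]
      · rw [if_pos (by omega)]
      · intro b _ hb
        rw [if_neg (by omega)]
    · exact sum_eq_zero fun b _ => if_neg (by omega)
  rw [sum_congr rfl h, ← sum_filter]
  congr 1
  ext x
  simp only [mem_filter, mem_range]
  omega

theorem sum_digit_signSum_add {p w : ℕ} {t : K} (ht : t ≠ 0) (ht' : t - t⁻¹ ≠ 0) (hw : w < p) :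
    ∑ a ∈ range p, ∑ b ∈ range p, (if b + 2 * a = w + p ∧ a + b < p then signSum t b else 0) =
      quantumNat t (p - 1 - w) := by
  rw [← sum_signSum ht ht']
  have h : ∀ a ∈ range p, ∑ b ∈ range p,
      (if b + 2 * a = w + p ∧ a + b < p then signSum t b else 0) =
        if w + 1 ≤ a ∧ 2 * a ≤ w + p then signSum t (w + p - 2 * a) else 0 := by
    intro a ha
    rw [mem_range] at ha
    split_ifs with h
    · rw [sum_eq_single_of_mem (w + p - 2 * a) (by rw [mem_range]; omega)]
      · rw [if_pos (by omega)]
      · intro b _ hb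
        rw [if_neg (by omega)]
    · exact sum_eq_zero fun b _ => if_neg (by omega)
  rw [sum_congr rfl h, ← sum_filter]
  refine sum_bij' (fun a _ => a - (w + 1)) (fun a _ => a + (w + 1)) ?_ ?_ ?_ ?_ ?_
  all_goals intro a ha
  all_goals simp only [mem_filter, mem_range] at ha ⊢
  all_goals first | omega | (congr 1; omega)

theorem noCarrySum_succ {p z₀ : ℕ} (k : ℕ) {t : K} (ht : t ≠ 0) (ht' : t - t⁻¹ ≠ 0)
    (hz : z₀ < p) (z : ℕ) :
    noCarrySum p (k + 1) t (p * z + z₀ + 1) =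
      noCarrySum p k (t ^ p) (z + 1) * quantumNat t (z₀ + 1) +
        noCarrySum p k (t ^ p) z * quantumNat t (p - 1 - z₀) := by
  rw [← sum_digit_signSum_of_lt ht ht' hz, ← sum_digit_signSum_add ht ht' hz, noCarrySum,
    noCarrySum, noCarrySum, ← sum_sum_sum_sum_mul, ← sum_sum_sum_sum_mul, pow_succ',
    sum_range_mul_digit]
  simp only [sum_range_mul_digit, ← sum_add_distrib]
  refine sum_congr rfl fun a _ => sum_congr rfl fun a₀ ha => sum_congr rfl fun b _ =>
    sum_congr rfl fun b₀ hb => ?_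
  rw [mem_range] at ha hb
  simp only [noCarry_mul_add ha hb, supportSum_succ k ht hb]
  by_cases hN : NoCarry p a b
  swap
  · simp [hN]
  by_cases h₀ : a₀ + b₀ < p
  swap
  · simp [h₀]
  have hiff : p * b + b₀ + 2 * (p * a + a₀) + 1 = p * z + z₀ + 1 ↔
      (b + 2 * a = z ∧ b₀ + 2 * a₀ = z₀) ∨ (b + 2 * a + 1 = z ∧ b₀ + 2 * a₀ = z₀ + p) := by
    rw [← mul_add_eq_mul_add_iff_of_lt_two_mul (by omega) hz, add_left_inj]
    ring_nf
  simp only [hiff, hN, h₀, and_true, add_left_inj]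
  split_ifs <;> first | omega | simp [mul_comm]

theorem quantumNat_mul_add {p z₀ : ℕ} {t : K} (ht : t ≠ 0) (ht' : t - t⁻¹ ≠ 0)
    (htp : t ^ p - (t ^ p)⁻¹ ≠ 0) (hz : z₀ < p) (z : ℕ) :
    quantumNat t (p * z + z₀ + 1) =
      quantumNat (t ^ p) (z + 1) * quantumNat t (z₀ + 1) +
        quantumNat (t ^ p) z * quantumNat t (p - 1 - z₀) := by
  obtain ⟨d, rfl⟩ : ∃ d, p = z₀ + 1 + d := ⟨p - (z₀ + 1), by omega⟩
  have e : t ^ ((z₀ + 1 + d) * z + z₀ + 1) = (t ^ (z₀ + 1 + d)) ^ z * t ^ (z₀ + 1) := by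
    rw [← pow_mul, ← pow_add, add_assoc]
  rw [show z₀ + 1 + d - 1 - z₀ = d by omega]
  simp only [quantumNat, inv_pow, e]
  rw [div_mul_div_comm, div_mul_div_comm, ← add_div, div_eq_div_iff ht' (mul_ne_zero htp ht')]
  have hd : t ^ d = t ^ (z₀ + 1 + d) / t ^ (z₀ + 1) := by
    rw [eq_div_iff (pow_ne_zero _ ht), mul_comm, ← pow_add]
  rw [pow_succ _ z, hd]
  have hX : (t ^ (z₀ + 1 + d)) ^ z ≠ 0 := pow_ne_zero _ (pow_ne_zero _ ht)
  have hu : t ^ (z₀ + 1 + d) ≠ 0 := pow_ne_zero _ ht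
  have hs : t ^ (z₀ + 1) ≠ 0 := pow_ne_zero _ ht
  clear e hd
  generalize (t ^ (z₀ + 1 + d)) ^ z = X at *
  generalize t ^ (z₀ + 1 + d) = u at *
  generalize t ^ (z₀ + 1) = s at *
  generalize t - t⁻¹ = y
  field_simp
  ring

theorem signSum_mul_add {p z₀ : ℕ} {t : K} (ht : t ≠ 0) (htp : t ^ p - (t ^ p)⁻¹ ≠ 0)
    (hz : z₀ < p) (h₀ : z₀ ≠ 0) (z : ℕ) :
    quantumNat (t ^ p) (z + 1) * signSum t z₀ - quantumNat (t ^ p) z * signSum t (p - z₀) =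
      signSum t (p * z + z₀) := by
  obtain ⟨d, rfl⟩ : ∃ d, p = z₀ + d := ⟨p - z₀, by omega⟩
  have e : t ^ ((z₀ + d) * z + z₀) = (t ^ (z₀ + d)) ^ z * t ^ z₀ := by
    rw [← pow_mul, ← pow_add]
  rw [show z₀ + d - z₀ = d by omega, signSum, signSum, signSum, if_neg h₀, if_neg (by omega),
    if_neg (by omega)]
  simp only [quantumNat, inv_pow, e]
  have hd : t ^ d = t ^ (z₀ + d) / t ^ z₀ := by
    rw [eq_div_iff (pow_ne_zero _ ht), mul_comm, ← pow_add]
  rw [pow_succ _ z, hd, div_mul_eq_mul_div, div_mul_eq_mul_div, ← sub_div, div_eq_iff htp]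
  have hX : (t ^ (z₀ + d)) ^ z ≠ 0 := pow_ne_zero _ (pow_ne_zero _ ht)
  have hu : t ^ (z₀ + d) ≠ 0 := pow_ne_zero _ ht
  have hs : t ^ z₀ ≠ 0 := pow_ne_zero _ ht
  clear e hd
  generalize (t ^ (z₀ + d)) ^ z = X at *
  generalize t ^ (z₀ + d) = u at *
  generalize t ^ z₀ = s at *
  field_simp
  ring

theorem sub_inv_ne_zero_of_pow_ne_one {t : K} (ht : t ≠ 0) (h : ∀ n, n ≠ 0 → t ^ n ≠ 1) :
    t - t⁻¹ ≠ 0 := by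
  intro e
  apply h 2 two_ne_zero
  rw [sub_eq_zero] at e
  rw [sq]
  nth_rewrite 2 [e]
  exact mul_inv_cancel₀ ht

theorem pow_pow_ne_one {p : ℕ} (hp : p ≠ 0) {t : K} (h : ∀ n, n ≠ 0 → t ^ n ≠ 1) (n : ℕ)
    (hn : n ≠ 0) : (t ^ p) ^ n ≠ 1 := by
  rw [← pow_mul]
  exact h _ (mul_ne_zero hp hn)

theorem noCarrySum_eq_quantumNat {p : ℕ} (hp : 0 < p) (k : ℕ) :
    ∀ {t : K}, t ≠ 0 → (∀ n, n ≠ 0 → t ^ n ≠ 1) → ∀ {w : ℕ}, w ≤ p ^ k →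
      noCarrySum p k t w = quantumNat t w := by
  induction k with
  | zero =>
    intro t ht h w hw
    have ht' := sub_inv_ne_zero_of_pow_ne_one ht h
    have hN : NoCarry p 0 0 := fun i => by simpa [pDigit] using hp
    have hS : PSub p 0 0 := fun i => Or.inl (by simp [pDigit])
    rw [pow_zero] at hw
    interval_cases w
    · simp [noCarrySum, quantumNat]
    · rw [noCarrySum, pow_zero, sum_range_one, sum_range_one, if_pos ⟨rfl, hN⟩]
      simp [quantumNat, supportSum, hS, ht']
  | succ k ih =>
    intro t ht h w hw
    have ht' := sub_inv_ne_zero_of_pow_ne_one ht h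
    have hp₀ : t ^ p ≠ 0 := pow_ne_zero _ ht
    have hpn := pow_pow_ne_one hp.ne' h
    have htp := sub_inv_ne_zero_of_pow_ne_one hp₀ hpn
    rcases w with _ | w
    · simp [noCarrySum, quantumNat]
    · have hwk : w / p < p ^ k := by
        rw [Nat.div_lt_iff_lt_mul hp, ← pow_succ]
        omega
      rw [← Nat.div_add_mod w p, noCarrySum_succ k ht ht' (Nat.mod_lt _ hp),
        quantumNat_mul_add ht ht' htp (Nat.mod_lt _ hp), ih hp₀ hpn hwk, ih hp₀ hpn hwk.le]

/-- The sum of `supportSum` over all `b` with `b + 2 * a = z`, weighted by `precSign p a b`. -/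
noncomputable def precSum (p k : ℕ) (t : K) (z : ℕ) : K :=
  ∑ a ∈ range (p ^ k), ∑ b ∈ range (p ^ k),
    if b + 2 * a = z then (precSign p a b : K) * supportSum p k t b else 0

theorem sum_sum_ite_eq_single {p x y : ℕ} (hx : x < p) (hy : y < p) (P : ℕ → ℕ → Prop)
    [∀ a b, Decidable (P a b)] (c : ℕ → ℕ → K) (h : ∀ a < p, ∀ b < p, P a b ↔ a = x ∧ b = y) :
    ∑ a ∈ range p, ∑ b ∈ range p, (if P a b then c a b else 0) = c x y := by
  rw [sum_eq_single_of_mem x (mem_range.2 hx), sum_eq_single_of_mem y (mem_range.2 hy),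
    if_pos ((h x hx y hy).2 ⟨rfl, rfl⟩)]
  · exact fun b hb hne => if_neg fun hP => hne ((h x hx b (mem_range.1 hb)).1 hP).2
  · exact fun a ha hne => sum_eq_zero fun b hb =>
      if_neg fun hP => hne ((h a (mem_range.1 ha) b (mem_range.1 hb)).1 hP).1

theorem precSum_succ_mul {p : ℕ} (hp : p.Prime) (k : ℕ) {t : K} (ht : t ≠ 0) (z : ℕ) :
    precSum p (k + 1) t (p * z) = precSum p k (t ^ p) z := by
  have key : ∑ a ∈ range p, ∑ b ∈ range p, (if a = 0 ∧ b = 0 then (1 : K) else 0) = 1 :=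
    sum_sum_ite_eq_single hp.pos hp.pos (fun a b => a = 0 ∧ b = 0) (fun _ _ => (1 : K))
       (fun _ _ _ _ => Iff.rfl)
  rw [← mul_one (precSum p k (t ^ p) z), ← key, precSum, precSum, ← sum_sum_sum_sum_mul, pow_succ',
    sum_range_mul_digit]
  simp only [sum_range_mul_digit]
  refine sum_congr rfl fun a _ => sum_congr rfl fun a₀ ha => sum_congr rfl fun b _ =>
    sum_congr rfl fun b₀ hb => ?_
  rw [mem_range] at ha hb
  rw [supportSum_succ k ht hb]
  rcases eq_or_ne b₀ 0 with rfl | h₀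
  · rw [precSign_mul_add_mul hp ha]
    rcases eq_or_ne a₀ 0 with rfl | h₁
    · have hc : p * b + 0 + 2 * (p * a + 0) = p * z ↔ b + 2 * a = z := by
        rw [← Nat.mul_right_inj hp.ne_zero (b := b + 2 * a)]
        ring_nf
      simp only [hc]
      simp [signSum]
    · simp [h₁]
  · rw [precSign_mul_add_of_ne_zero ha hb h₀]
    have hiff : p * b + b₀ + 2 * (p * a + a₀) = p * z ↔
        p * (b + 2 * a) + (b₀ + 2 * a₀) = p * z + 0 := by ring_nf
    by_cases h₁ : a₀ = 0
    · have hc : ¬ p * b + b₀ + 2 * (p * a + a₀) = p * z := by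
        rw [hiff, mul_add_eq_mul_add_iff (by omega) hp.pos]
        omega
      simp [hc, h₀]
    · by_cases h₂ : a₀ + b₀ = p
      · have hc : ¬ p * b + b₀ + 2 * (p * a + a₀) = p * z := by
          rw [hiff, mul_add_eq_mul_add_iff_of_lt_two_mul (by omega) hp.pos]
          omega
        simp [hc, h₀]
      · simp [h₀, h₁, h₂]

theorem precSum_succ_mul_add {p z₀ : ℕ} (k : ℕ) {t : K} (ht : t ≠ 0) (hz : z₀ < p)
    (hz₀ : z₀ ≠ 0) (hp : p.Prime) (z : ℕ) :
    precSum p (k + 1) t (p * z + z₀) =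
      noCarrySum p k (t ^ p) (z + 1) * signSum t z₀ -
        noCarrySum p k (t ^ p) z * signSum t (p - z₀) := by
  have key₁ : ∑ a ∈ range p, ∑ b ∈ range p, (if a = 0 ∧ b = z₀ then signSum t b else 0) =
      signSum t z₀ :=
    sum_sum_ite_eq_single hp.pos hz (fun a b => a = 0 ∧ b = z₀) (fun _ b => signSum t b)
       (fun _ _ _ _ => Iff.rfl)
  have key₂ : ∑ a ∈ range p, ∑ b ∈ range p,
      (if a = z₀ ∧ b = p - z₀ then signSum t b else 0) = signSum t (p - z₀) :=
    sum_sum_ite_eq_single hz (by omega) (fun a b => a = z₀ ∧ b = p - z₀) (fun _ b => signSum t b)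
       (fun _ _ _ _ => Iff.rfl)
  rw [← key₁, ← key₂, precSum, noCarrySum, noCarrySum, ← sum_sum_sum_sum_mul,
    ← sum_sum_sum_sum_mul, pow_succ', sum_range_mul_digit]
  simp only [sum_range_mul_digit, ← sum_sub_distrib]
  refine sum_congr rfl fun a _ => sum_congr rfl fun a₀ ha => sum_congr rfl fun b _ =>
    sum_congr rfl fun b₀ hb => ?_
  rw [mem_range] at ha hb
  rw [supportSum_succ k ht hb]
  have hiff : p * b + b₀ + 2 * (p * a + a₀) = p * z + z₀ ↔
      p * (b + 2 * a) + (b₀ + 2 * a₀) = p * z + z₀ := by ring_nf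
  rcases eq_or_ne b₀ 0 with rfl | h₀
  · rw [precSign_mul_add_mul hp ha, if_neg (show ¬(a₀ = 0 ∧ 0 = z₀) by omega),
      if_neg (show ¬(a₀ = z₀ ∧ 0 = p - z₀) by omega)]
    by_cases h₁ : a₀ = 0
    · have hc : ¬ p * b + 0 + 2 * (p * a + a₀) = p * z + z₀ := by
        rw [hiff, mul_add_eq_mul_add_iff (by omega) hz]
        omega
      rw [if_neg hc, mul_zero, mul_zero, sub_zero]
    · simp [h₁]
  · rw [precSign_mul_add_of_ne_zero ha hb h₀]
    by_cases hN : NoCarry p a b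
    swap
    · simp [hN]
    simp only [hN, and_true, if_true, add_left_inj]
    by_cases h₁ : a₀ = 0
    · have hc := hiff.trans (mul_add_eq_mul_add_iff (by omega) hz)
      simp only [hc]
      split_ifs <;> first | omega | simp [mul_comm]
    · rw [if_neg h₁]
      by_cases h₂ : a₀ + b₀ = p
      · have hc := hiff.trans (mul_add_eq_mul_add_iff_of_lt_two_mul (by omega) hz)
        simp only [hc, if_pos h₂]
        split_ifs <;> first | omega | simp [mul_comm]
      · rw [if_neg h₂]
        split_ifs <;> first | omega | simp

theorem precSum_eq {p : ℕ} (hp : p.Prime) (k : ℕ) :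
    ∀ {t : K}, t ≠ 0 → (∀ n, n ≠ 0 → t ^ n ≠ 1) → ∀ {z : ℕ}, z ≠ 0 → z < p ^ k →
      precSum p k t z = signSum t z := by
  induction k with
  | zero =>
    intro t _ _ z hz hz'
    rw [pow_zero] at hz'
    omega
  | succ k ih =>
    intro t ht h z hz hz'
    have hp₀ : t ^ p ≠ 0 := pow_ne_zero _ ht
    have hpn := pow_pow_ne_one hp.ne_zero h
    have htp := sub_inv_ne_zero_of_pow_ne_one hp₀ hpn
    have hzk : z / p < p ^ k := by
      rwa [Nat.div_lt_iff_lt_mul hp.pos, ← pow_succ]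
    by_cases h₀ : z % p = 0
    · obtain ⟨y, rfl⟩ := Nat.dvd_of_mod_eq_zero h₀
      rw [Nat.mul_div_cancel_left _ hp.pos] at hzk
      have hy : y ≠ 0 := right_ne_zero_of_mul hz
      rw [precSum_succ_mul hp k ht, ih hp₀ hpn hy hzk, signSum, signSum, if_neg hy, if_neg hz,
        inv_pow, inv_pow, ← pow_mul]
    · have hm := Nat.mod_lt z hp.pos
      rw [← Nat.div_add_mod z p, precSum_succ_mul_add k ht hm h₀ hp,
        noCarrySum_eq_quantumNat hp.pos k hp₀ hpn hzk,
        noCarrySum_eq_quantumNat hp.pos k hp₀ hpn hzk.le, signSum_mul_add ht htp hm h₀]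

end Sums

section Inverse

open Finset

theorem single_one_zpow (n : ℤ) :
    (HahnSeries.single (1 : ℤ) (1 : ℚ)) ^ n = HahnSeries.single n (1 : ℚ) :=
  (RatFunc.single_zpow n).symm

/-- The coefficient of `t ^ x` in the expansion of `t ^ z + t ^ (-z)` into support sums. -/
theorem sum_precSign_mul_pSub {p : ℕ} (hp : p.Prime) {k x z : ℕ} (hx : x ≠ 0) (hz : z ≠ 0)
    (hzk : z < p ^ k) :
    ∑ a ∈ range (p ^ k), ∑ b ∈ range (p ^ k), (if b + 2 * a = z then
      precSign p a b * ∑ c ∈ range (p ^ k), (if PSub p c b ∧ x + 2 * c = b then 1 else 0) else 0) =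
        if x = z then 1 else 0 := by
  have hpow : ∀ n : ℕ, n ≠ 0 → (HahnSeries.single (1 : ℤ) (1 : ℚ)) ^ n ≠ 1 := by
    intro n hn h
    have := congrArg (fun f => HahnSeries.coeff f 0) h
    rw [← zpow_natCast, single_one_zpow] at this
    simp only [HahnSeries.coeff_single, HahnSeries.coeff_one, if_true] at this
    rw [if_neg (by omega)] at this
    exact zero_ne_one this
  have h := precSum_eq hp k (HahnSeries.single_ne_zero one_ne_zero) hpow hz hzk
  have h' := congrArg (HahnSeries.coeff.addMonoidHom (x : ℤ)) h
  rw [← Int.cast_inj (α := ℚ)]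
  convert h' using 1
  · simp only [precSum, map_sum]
    push_cast
    refine sum_congr rfl fun a _ => sum_congr rfl fun b _ => ?_
    split_ifs with hab
    · rw [← zsmul_eq_mul (supportSum p k _ b), map_zsmul, zsmul_eq_mul, supportSum, map_sum]
      congr 1
      refine sum_congr rfl fun c _ => ?_
      by_cases hS : PSub p c b
      · rw [if_pos hS, single_one_zpow, HahnSeries.coeff.addMonoidHom_apply,
          HahnSeries.coeff_single]
        simp only [hS, true_and]
        congr 1
        apply propext
        omega
      · simp [hS]
    · simp
  · rw [signSum, if_neg hz, map_add, inv_pow, ← zpow_natCast, ← zpow_neg, single_one_zpow,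
      single_one_zpow, HahnSeries.coeff.addMonoidHom_apply, HahnSeries.coeff.addMonoidHom_apply,
      HahnSeries.coeff_single, HahnSeries.coeff_single, if_neg (show ¬ (x : ℤ) = -z by omega)]
    simp

theorem sum_ite_add_two_mul_eq {x b N : ℕ} (hb : b < N) (P : ℕ → Prop) (f : ℕ → ℤ) :
    ∑ c ∈ range N, (if P c ∧ x + 2 * c = b then f c else 0) =
      if x ≤ b ∧ (b - x) % 2 = 0 ∧ P ((b - x) / 2) then f ((b - x) / 2) else 0 := by
  by_cases h : x ≤ b ∧ (b - x) % 2 = 0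
  · rw [sum_eq_single_of_mem ((b - x) / 2) (by rw [mem_range]; omega)]
    · have : x + 2 * ((b - x) / 2) = b := by omega
      simp [this, h]
    · exact fun c _ hc => if_neg fun h' => hc (by omega)
  · rw [if_neg (by tauto)]
    exact sum_eq_zero fun c _ => if_neg (by omega)

theorem matB_apply_eq_sum (p n : ℕ) {N : ℕ} (hN : n < N) (i j : Fin n) :
    matB p n i j = ∑ c ∈ range N,
      if PSub p c (n - j) ∧ (n - i) + 2 * c = n - (j : ℕ) then 1 else 0 := by
  rw [sum_ite_add_two_mul_eq (by omega) (fun c => PSub p c (n - j)) (fun _ => 1), matB,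
    show n - (j : ℕ) - (n - i) = i - j by omega]
  have : n - (i : ℕ) ≤ n - j ↔ (j : ℕ) ≤ i := by omega
  simp only [this]

theorem matA_apply_eq_sum (p n : ℕ) {N : ℕ} (hN : n < N) (i j : Fin n) :
    matA p n i j = ∑ a ∈ range N,
      if (n - i) + 2 * a = n - (j : ℕ) then precSign p a (n - i) else 0 := by
  have h := sum_ite_add_two_mul_eq (x := n - i) (show n - (j : ℕ) < N by omega) (fun _ => True)
    (fun a => precSign p a (n - i))
  simp only [true_and, and_true] at h
  rw [h, matA, show n - (j : ℕ) - (n - i) = i - j by omega, precSign,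
    if_neg (show ¬ n - (i : ℕ) = 0 by omega)]
  have : n - (i : ℕ) ≤ n - j ↔ (j : ℕ) ≤ i := by omega
  simp only [this]
  by_cases h₁ : (j : ℕ) ≤ i <;> by_cases h₂ : ((i : ℕ) - j) % 2 = 0 <;> simp [h₁, h₂]

theorem sum_fin_sub_eq_sum_range {n N : ℕ} (hN : n < N) (g : ℕ → ℤ) (h₀ : g 0 = 0)
    (hg : ∀ b, n < b → g b = 0) : ∑ l : Fin n, g (n - l) = ∑ b ∈ range N, g b := by
  rw [Fin.sum_univ_eq_sum_range (fun l => g (n - l)) n, ← sum_subset (range_mono hN)]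
  · rw [Nat.succ_eq_add_one, sum_range_succ', h₀, add_zero, ← sum_range_reflect]
    refine sum_congr rfl fun l hl => ?_
    rw [mem_range] at hl
    congr 1
    omega
  · exact fun b _ hb => hg b (by simpa using hb)

theorem matB_mul_matA {p : ℕ} (hp : p.Prime) (n : ℕ) : matB p n * matA p n = 1 := by
  ext i j
  have hN : n < p ^ n := Nat.lt_pow_self hp.one_lt
  have h := sum_precSign_mul_pSub hp (k := n) (x := n - i) (z := n - j) (by omega) (by omega)
    (by omega)
  rw [sum_comm] at h
  simp only [← ite_zero_mul, ← sum_mul] at h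
  rw [← sum_fin_sub_eq_sum_range hN] at h
  · rw [Matrix.mul_apply, Matrix.one_apply]
    simp only [matB_apply_eq_sum p n hN, matA_apply_eq_sum p n hN]
    simp only [mul_comm] at h ⊢
    rw [h]
    congr 1
    rw [Fin.ext_iff]
    apply propext
    omega
  · simp [precSign]
  · intro b hb
    rw [sum_eq_zero fun a _ => if_neg (by omega), zero_mul]

end Inverse

/-- For every prime `p` and every `n ≥ 1`, the matrices `A(n)` and `B(n)` are inverse of each
other: `A(n) · B(n)` is the identity matrix. -/
theorem matA_mul_matB (p n : ℕ) (hp : p.Prime) (hn : 1 ≤ n) :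
    matA p n * matB p n = 1 := by
  exact mul_eq_one_comm.mp (matB_mul_matA hp n)
end

section
/- For every prime p and every integer N ≥ 2, one has C_p(N) = (p-1)·⌊log_p N⌋ + ⌊N / p^{⌊log_p N⌋}⌋. Equivalently, if N_h p^{s_h} is the leading term of the base-p expansion of N (N_h ≠ 0, s_h = ⌊log_p N⌋), then C_p(N) = (p-1)·s_h + N_h. -/
/-- `I_p(N)` : the set of integers `r` with `0 ≤ r ≤ N-1` such that `r < 2(p - R_f)p^f`,
where `R = N - r`, `f` is the `p`-adic valuation of `R` and `R_f` is the base-`p` digit of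
`R` at position `f`. -/
def IpSet (p N : ℕ) : Finset ℕ :=
  (Finset.range N).filter fun r =>
    r < 2 * (p - pDigit p (N - r) (padicValNat p (N - r))) * p ^ padicValNat p (N - r)

/-- `C_p(N)` : the cardinality of `I_p(N)`. -/
def Cp (p N : ℕ) : ℕ := (IpSet p N).card

/-- The condition defining `IpSet`, expressed in terms of `R = N - r`. -/
def IpCond (p N R : ℕ) : Prop :=
  N - R < 2 * (p - pDigit p R (padicValNat p R)) * p ^ padicValNat p R

instance (p N R : ℕ) : Decidable (IpCond p N R) := Nat.decLt _ _

theorem Cp_eq_card_filter_Icc (p N : ℕ) :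
    Cp p N = ((Finset.Icc 1 N).filter (IpCond p N)).card := by
  unfold Cp IpSet
  refine Finset.card_nbij' (fun r => N - r) (fun R => N - R) ?_ ?_ ?_ ?_
  · intro r hr
    simp only [Finset.coe_filter, Finset.mem_range, Set.mem_ofPred_eq, Finset.mem_Icc, IpCond]
      at hr ⊢
    refine ⟨by omega, ?_⟩
    rw [Nat.sub_sub_self hr.1.le]
    exact hr.2
  · intro R hR
    simp only [Finset.coe_filter, Finset.mem_range, Set.mem_ofPred_eq, Finset.mem_Icc, IpCond]
      at hR ⊢
    refine ⟨by omega, ?_⟩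
    rw [Nat.sub_sub_self hR.1.2]
    exact hR.2
  · intro r hr
    simp only [Finset.coe_filter, Finset.mem_range, Set.mem_ofPred_eq] at hr
    exact Nat.sub_sub_self hr.1.le
  · intro R hR
    simp only [Finset.coe_filter, Set.mem_ofPred_eq, Finset.mem_Icc] at hR
    exact Nat.sub_sub_self hR.1.2

theorem ipCond_of_not_dvd {p N R : ℕ} (h : ¬ p ∣ R) :
    IpCond p N R ↔ N - R < 2 * (p - R % p) := by
  simp [IpCond, pDigit, padicValNat.eq_zero_of_not_dvd h]

theorem ipCond_mul_left {p N k : ℕ} (hp : p.Prime) (hk : k ≠ 0) :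
    IpCond p N (p * k) ↔ IpCond p (N / p) k := by
  have := Fact.mk hp
  have hv : padicValNat p (p * k) = padicValNat p k + 1 := by
    rw [padicValNat.mul hp.ne_zero hk, padicValNat_self, add_comm]
  have hd : pDigit p (p * k) (padicValNat p k + 1) = pDigit p k (padicValNat p k) := by
    rw [pDigit, pDigit, pow_succ', Nat.mul_div_mul_left _ _ hp.pos]
  rw [IpCond, IpCond, hv, hd, pow_succ, ← mul_assoc, ← Nat.div_lt_iff_lt_mul hp.pos,
    Nat.sub_mul_div]

theorem card_filter_dvd_ipCond {p : ℕ} (hp : p.Prime) (N : ℕ) :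
    ((Finset.Icc 1 N).filter (fun R => IpCond p N R ∧ p ∣ R)).card = Cp p (N / p) := by
  rw [Cp_eq_card_filter_Icc]
  symm
  refine Finset.card_nbij (fun k => p * k) ?_ ?_ ?_
  · intro k hk
    simp only [Finset.coe_filter, Set.mem_ofPred_eq, Finset.mem_Icc] at hk ⊢
    refine ⟨⟨Nat.mul_pos hp.pos hk.1.1, ?_⟩,
      (ipCond_mul_left hp (by omega)).2 hk.2, dvd_mul_right _ _⟩
    rw [mul_comm]
    exact (Nat.le_div_iff_mul_le hp.pos).1 hk.1.2
  · intro a _ b _ h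
    exact Nat.eq_of_mul_eq_mul_left hp.pos h
  · intro R hR
    simp only [Finset.coe_filter, Set.mem_ofPred_eq, Finset.mem_Icc] at hR
    obtain ⟨⟨hpos, hle⟩, hc, k, rfl⟩ := hR
    have hk : k ≠ 0 := by rintro rfl; simp at hpos
    have hkN : k ≤ N / p := (Nat.le_div_iff_mul_le hp.pos).2 (by rwa [mul_comm])
    refine ⟨k, ?_, rfl⟩
    simp only [Finset.coe_filter, Set.mem_ofPred_eq, Finset.mem_Icc]
    exact ⟨⟨by omega, hkN⟩, (ipCond_mul_left hp hk).1 hc⟩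

theorem filter_not_dvd_ipCond {p N : ℕ} (hp : 0 < p) (h : p ≤ N) :
    (Finset.Icc 1 N).filter (fun R => IpCond p N R ∧ ¬ p ∣ R) =
      Finset.Ioc (N - N % p) N ∪ Finset.Ioo (N - N % p - p) (N - 2 * (N % p)) := by
  ext R
  simp only [Finset.mem_filter, Finset.mem_Icc, Finset.mem_union, Finset.mem_Ioc, Finset.mem_Ioo]
  have hN := Nat.div_add_mod N p
  have hR := Nat.div_add_mod R p
  have hNp := Nat.mod_lt N hp
  have hRp := Nat.mod_lt R hp
  have hq : 1 ≤ N / p := (Nat.one_le_div_iff hp).2 h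
  by_cases hd : p ∣ R
  · obtain ⟨k, rfl⟩ := hd
    simp only [dvd_mul_right, not_true, and_false, false_iff]
    generalize N / p = q at *
    generalize N % p = t at *
    rintro (⟨h1, h2⟩ | ⟨h1, h2⟩)
    · have h3 : p * q < p * k := by omega
      have h4 : p * k < p * (q + 1) := by rw [mul_add]; omega
      have := Nat.lt_of_mul_lt_mul_left h3
      have := Nat.lt_of_mul_lt_mul_left h4
      omega
    · have h3 : p * q < p * (k + 1) := by rw [mul_add]; omega
      have h4 : p * k < p * q := by omega
      have := Nat.lt_of_mul_lt_mul_left h3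
      have := Nat.lt_of_mul_lt_mul_left h4
      omega
  · rw [ipCond_of_not_dvd hd]
    have hd0 : R % p ≠ 0 := fun h0 => hd (Nat.dvd_of_mod_eq_zero h0)
    simp only [hd, not_false_eq_true, and_true]
    generalize N / p = q at *
    generalize N % p = t at *
    generalize R / p = m at *
    generalize R % p = d at *
    obtain hm | hm | hm | hm : q < m ∨ m = q ∨ q = m + 1 ∨ m + 2 ≤ q := by omega
    · have := Nat.mul_le_mul_left p (show q + 1 ≤ m from hm)
      rw [mul_add] at this
      omega
    · subst hm; omega
    · subst hm
      rw [mul_add] at hN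
      omega
    · have := Nat.mul_le_mul_left p hm
      rw [mul_add] at this
      omega

theorem card_filter_not_dvd_ipCond {p N : ℕ} (hp : 0 < p) (h : p ≤ N) :
    ((Finset.Icc 1 N).filter (fun R => IpCond p N R ∧ ¬ p ∣ R)).card = p - 1 := by
  have hNp := Nat.mod_lt N hp
  have hN := Nat.div_add_mod N p
  have hq := Nat.mul_le_mul_left p ((Nat.one_le_div_iff hp).2 h)
  rw [filter_not_dvd_ipCond hp h, Finset.card_union_of_disjoint, Nat.card_Ioc, Nat.card_Ioo]
  · omega
  · rw [Finset.disjoint_left]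
    intro R
    simp only [Finset.mem_Ioc, Finset.mem_Ioo]
    omega

theorem Cp_of_lt {p N : ℕ} (h : N < p) : Cp p N = N := by
  rw [Cp_eq_card_filter_Icc, Finset.filter_true_of_mem, Nat.card_Icc, Nat.add_sub_cancel]
  intro R hR
  rw [Finset.mem_Icc] at hR
  rw [ipCond_of_not_dvd (Nat.not_dvd_of_pos_of_lt hR.1 (by omega)), Nat.mod_eq_of_lt (by omega)]
  omega

theorem Cp_of_le {p N : ℕ} (hp : p.Prime) (h : p ≤ N) : Cp p N = Cp p (N / p) + (p - 1) := by
  rw [← card_filter_dvd_ipCond hp, ← card_filter_not_dvd_ipCond hp.pos h, Cp_eq_card_filter_Icc,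
    ← Finset.card_filter_add_card_filter_not (fun R => p ∣ R), Finset.filter_filter,
    Finset.filter_filter]

theorem Cp_eq_of_prime {p : ℕ} (hp : p.Prime) (N : ℕ) :
    Cp p N = (p - 1) * Nat.log p N + N / p ^ Nat.log p N := by
  induction N using Nat.strong_induction_on with
  | _ N ih =>
    obtain h | h := lt_or_ge N p
    · simp [Cp_of_lt h, Nat.log_of_lt h]
    · rw [Cp_of_le hp h, ih _ (Nat.div_lt_self (hp.pos.trans_le h) hp.one_lt),
        Nat.log_of_one_lt_of_le hp.one_lt h, pow_succ', ← Nat.div_div_eq_div_mul]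
      ring

/-- For every prime `p` and every integer `N ≥ 2`,
`C_p(N) = (p-1)·⌊log_p N⌋ + ⌊N / p^{⌊log_p N⌋}⌋`; the second summand is the leading base-`p`
digit `N_h` of `N`, and `⌊log_p N⌋ = s_h` is its position. -/
theorem Cp_eq (p N : ℕ) (hp : p.Prime) (hN : 2 ≤ N) :
    Cp p N = (p - 1) * Nat.log p N + N / p ^ Nat.log p N :=
  Cp_eq_of_prime hp N
end

section
/- Let p be a prime and N ≥ 2 an integer. If N+1 has exactly one nonzero digit in base p, i.e. N+1 = d·p^t for some integers t ≥ 0 and 1 ≤ d ≤ p-1, then C_p(N+1) = C_p(N) + 1; otherwise C_p(N+1) = C_p(N). -/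
/-- The first `N` for which `N - R` no longer lies in `I_p(N)`: a positive integer `R`
contributes to `C_p(N)` exactly for `R ≤ N < lifetimeEnd p R`. -/
def lifetimeEnd (p R : ℕ) : ℕ :=
  R + 2 * (p - pDigit p R (padicValNat p R)) * p ^ padicValNat p R

theorem exists_lowest_digit {p n : ℕ} (hp : p.Prime) (hn : n ≠ 0) :
    ∃ q e f : ℕ, 0 < e ∧ e < p ∧ n = (q * p + e) * p ^ f := by
  obtain ⟨f, m, hm, rfl⟩ := Nat.exists_eq_pow_mul_and_not_dvd hn p hp.ne_one
  refine ⟨m / p, m % p, f, ?_, Nat.mod_lt _ hp.pos, ?_⟩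
  · exact Nat.pos_of_ne_zero fun h => hm (Nat.dvd_of_mod_eq_zero h)
  · rw [Nat.div_add_mod', mul_comm]

theorem padicValNat_lowest_digit {p q e f : ℕ} (hp : p.Prime) (he : 0 < e) (hep : e < p) :
    padicValNat p ((q * p + e) * p ^ f) = f := by
  have : Fact p.Prime := ⟨hp⟩
  have hnd : ¬ p ∣ q * p + e := fun h =>
    Nat.not_dvd_of_pos_of_lt he hep ((Nat.dvd_add_right (dvd_mul_left p q)).1 h)
  rw [padicValNat.mul (by omega) (pow_ne_zero _ hp.ne_zero), padicValNat.prime_pow,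
    padicValNat.eq_zero_of_not_dvd hnd, zero_add]

theorem lowest_digit_unique {p q e f q' e' f' : ℕ} (hp : p.Prime) (he : 0 < e) (hep : e < p)
    (he' : 0 < e') (hep' : e' < p) (h : (q * p + e) * p ^ f = (q' * p + e') * p ^ f') :
    q = q' ∧ e = e' ∧ f = f' := by
  have hf : f = f' := by
    rw [← padicValNat_lowest_digit (q := q) (f := f) hp he hep, h,
      padicValNat_lowest_digit hp he' hep']
  subst hf
  have h1 : q * p + e = q' * p + e' := Nat.eq_of_mul_eq_mul_right (pow_pos hp.pos f) h
  have h2 : e = e' := by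
    simpa [Nat.mul_add_mod', Nat.mod_eq_of_lt, hep, hep'] using congrArg (· % p) h1
  subst h2
  exact ⟨Nat.eq_of_mul_eq_mul_right hp.pos (Nat.add_right_cancel h1), rfl, rfl⟩

theorem lifetimeEnd_lowest_digit {p q e f : ℕ} (hp : p.Prime) (he : 0 < e) (hep : e < p) :
    lifetimeEnd p ((q * p + e) * p ^ f) = ((q + 1) * p + (p - e)) * p ^ f := by
  obtain ⟨c, rfl⟩ := Nat.exists_eq_add_of_lt hep
  rw [lifetimeEnd, padicValNat_lowest_digit hp he hep, pDigit,
    Nat.mul_div_cancel _ (pow_pos hp.pos f), Nat.mul_add_mod', Nat.mod_eq_of_lt hep]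
  have : e + c + 1 - e = c + 1 := by omega
  rw [this]
  ring

theorem lt_lifetimeEnd {p R : ℕ} (hp : p.Prime) : R < lifetimeEnd p R := by
  have h : pDigit p R (padicValNat p R) < p := Nat.mod_lt _ hp.pos
  exact Nat.lt_add_of_pos_right
    (Nat.mul_pos (Nat.mul_pos two_pos (Nat.sub_pos_of_lt h)) (pow_pos hp.pos _))

theorem Cp_eq_card_lifetimeEnd (p N : ℕ) :
    Cp p N = ((Finset.Icc 1 N).filter fun R => N < lifetimeEnd p R).card := by
  refine Finset.card_bij' (fun r _ => N - r) (fun R _ => N - R) ?_ ?_ ?_ ?_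
  · intro r hr
    simp only [IpSet, Finset.mem_filter, Finset.mem_range, Finset.mem_Icc] at hr ⊢
    unfold lifetimeEnd
    omega
  · intro R hR
    simp only [IpSet, Finset.mem_filter, Finset.mem_range, Finset.mem_Icc] at hR ⊢
    unfold lifetimeEnd at hR
    rw [Nat.sub_sub_self hR.1.2]
    omega
  · intro r hr
    simp only [IpSet, Finset.mem_filter, Finset.mem_range] at hr
    exact Nat.sub_sub_self hr.1.le
  · intro R hR
    simp only [Finset.mem_filter, Finset.mem_Icc] at hR
    exact Nat.sub_sub_self hR.1.2

theorem lifetimeEnd_injOn {p R R' : ℕ} (hp : p.Prime) (hR : R ≠ 0) (hR' : R' ≠ 0)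
    (h : lifetimeEnd p R = lifetimeEnd p R') : R = R' := by
  obtain ⟨q, e, f, he, hep, rfl⟩ := exists_lowest_digit hp hR
  obtain ⟨q', e', f', he', hep', rfl⟩ := exists_lowest_digit hp hR'
  rw [lifetimeEnd_lowest_digit hp he hep, lifetimeEnd_lowest_digit hp he' hep'] at h
  obtain ⟨h1, h2, rfl⟩ := lowest_digit_unique hp (by omega) (by omega) (by omega) (by omega) h
  obtain rfl : q = q' := by omega
  obtain rfl : e = e' := by omega
  rfl

/-- The positive integers with a single nonzero digit are exactly those that are not of the form
`lifetimeEnd p R` with `R` positive. -/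
theorem exists_lifetimeEnd_eq_iff {p M : ℕ} (hp : p.Prime) (hM : M ≠ 0) :
    (∃ R, R ≠ 0 ∧ lifetimeEnd p R = M) ↔
      ¬ ∃ t d : ℕ, 1 ≤ d ∧ d ≤ p - 1 ∧ M = d * p ^ t := by
  have hp0 := hp.pos
  constructor
  · rintro ⟨R, hR, rfl⟩ ⟨t, d, hd, hdp, h⟩
    obtain ⟨q, e, f, he, hep, rfl⟩ := exists_lowest_digit hp hR
    rw [lifetimeEnd_lowest_digit hp he hep] at h
    rw [← Nat.zero_add d, ← Nat.zero_mul p] at h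
    have := lowest_digit_unique hp (by omega) (by omega) hd (by omega) h
    omega
  · intro h
    obtain ⟨q, e, f, he, hep, rfl⟩ := exists_lowest_digit hp hM
    rcases q with _ | q
    · exact absurd ⟨f, e, he, by omega, by simp⟩ h
    · refine ⟨(q * p + (p - e)) * p ^ f,
        mul_ne_zero (by omega) (pow_ne_zero _ hp.ne_zero), ?_⟩
      rw [lifetimeEnd_lowest_digit hp (by omega) (by omega), Nat.sub_sub_self hep.le]

/-- Let `p` be a prime and `N ≥ 2`. If `N+1` has exactly one nonzero digit in base `p`,
i.e. `N+1 = d·p^t` with `t ≥ 0` and `1 ≤ d ≤ p-1`, then `C_p(N+1) = C_p(N) + 1`;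
otherwise `C_p(N+1) = C_p(N)`. -/
theorem Cp_succ (p N : ℕ) (hp : p.Prime) (hN : 2 ≤ N) :
    ((∃ t d : ℕ, 1 ≤ d ∧ d ≤ p - 1 ∧ N + 1 = d * p ^ t) → Cp p (N + 1) = Cp p N + 1) ∧
    (¬ (∃ t d : ℕ, 1 ≤ d ∧ d ≤ p - 1 ∧ N + 1 = d * p ^ t) → Cp p (N + 1) = Cp p N) := by
  have hlt : ∀ R, R < lifetimeEnd p R := fun R => lt_lifetimeEnd hp
  rw [Cp_eq_card_lifetimeEnd, Cp_eq_card_lifetimeEnd]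
  constructor
  · intro h
    have hne : ∀ R, R ≠ 0 → lifetimeEnd p R ≠ N + 1 := fun R hR hEq =>
      (exists_lifetimeEnd_eq_iff hp N.succ_ne_zero).1 ⟨R, hR, hEq⟩ h
    rw [← Finset.card_insert_of_notMem (a := N + 1) (by simp)]
    congr 1
    ext R
    simp only [Finset.mem_insert, Finset.mem_filter, Finset.mem_Icc]
    grind
  · intro h
    obtain ⟨R₀, hR₀, hEq⟩ := (exists_lifetimeEnd_eq_iff hp N.succ_ne_zero).2 h
    have huniq : ∀ R, R ≠ 0 → lifetimeEnd p R = N + 1 → R = R₀ := fun R hR hE =>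
      lifetimeEnd_injOn hp hR hR₀ (hE.trans hEq.symm)
    apply Nat.add_right_cancel (m := 1)
    rw [← Finset.card_insert_of_notMem (a := R₀) (by simp [hEq]),
      ← Finset.card_insert_of_notMem (a := N + 1) (by simp)]
    congr 1
    ext R
    simp only [Finset.mem_insert, Finset.mem_filter, Finset.mem_Icc]
    grind
end

section
/- Let p be a prime, N ≥ 2 an integer, and r ∈ I_p(N). Let f be the p-adic valuation of N - r. If r + p^f < N, then r + p^f ∈ I_p(N). -/
theorem padicValNat_pow_mul_of_not_dvd {p m : ℕ} (hp : p.Prime) (f : ℕ) (hm : ¬ p ∣ m) :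
    padicValNat p (p ^ f * m) = f := by
  have := Fact.mk hp
  have hm0 : m ≠ 0 := by
    rintro rfl
    exact hm (dvd_zero p)
  rw [padicValNat.mul (pow_ne_zero _ hp.ne_zero) hm0, padicValNat.prime_pow,
    padicValNat.eq_zero_of_not_dvd hm, add_zero]

theorem pDigit_pow_mul {p : ℕ} (hp : 0 < p) (f m : ℕ) : pDigit p (p ^ f * m) f = m % p := by
  rw [pDigit, Nat.mul_div_cancel_left _ (pow_pos hp f)]

/-- Let `p` be a prime, `N ≥ 2`, and `r ∈ I_p(N)`. With `f` the `p`-adic valuation of `N - r`,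
if `r + p^f < N` then `r + p^f ∈ I_p(N)`. -/
theorem add_pow_mem_IpSet (p N r : ℕ) (hp : p.Prime) (hN : 2 ≤ N) (hr : r ∈ IpSet p N)
    (h : r + p ^ padicValNat p (N - r) < N) :
    r + p ^ padicValNat p (N - r) ∈ IpSet p N := by
  have := Fact.mk hp
  simp only [IpSet, Finset.mem_filter, Finset.mem_range] at hr ⊢
  obtain ⟨hrN, hr⟩ := hr
  refine ⟨h, ?_⟩
  obtain ⟨f, m, hm, hR⟩ := Nat.exists_eq_pow_mul_and_not_dvd (n := N - r) (by omega) p hp.ne_one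
  rw [hR, padicValNat_pow_mul_of_not_dvd hp f hm] at h hr ⊢
  rw [pDigit_pow_mul hp.pos] at hr
  have hq : 0 < p ^ f := pow_pos hp.pos f
  have hR' : N - (r + p ^ f) = p ^ f * (m - 1) := by
    rw [Nat.mul_sub, ← hR]
    omega
  have hd : m % p ≠ 0 := fun h0 => hm (Nat.dvd_of_mod_eq_zero h0)
  have hdp : m % p < p := Nat.mod_lt _ hp.pos
  have hmod := Nat.div_add_mod m p
  by_cases hd1 : m % p = 1
  · have hdvd : p ^ (f + 1) ∣ N - (r + p ^ f) := by
      rw [hR', pow_succ]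
      exact mul_dvd_mul_left _ ⟨m / p, by omega⟩
    have hle : f + 1 ≤ padicValNat p (N - (r + p ^ f)) :=
      (padicValNat_dvd_iff_le (by omega)).1 hdvd
    have hdig : pDigit p (N - (r + p ^ f)) (padicValNat p (N - (r + p ^ f))) < p :=
      Nat.mod_lt _ hp.pos
    rw [hd1] at hr
    calc r + p ^ f < 2 * (p - 1) * p ^ f + 2 * p ^ f := by omega
      _ = 2 * 1 * p ^ (f + 1) := by
        obtain ⟨k, rfl⟩ := Nat.exists_eq_succ_of_ne_zero hp.ne_zero
        simp only [Nat.succ_eq_add_one, Nat.add_sub_cancel]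
        ring
      _ ≤ _ := Nat.mul_le_mul (Nat.mul_le_mul_left _ (by omega))
        (Nat.pow_le_pow_right hp.pos hle)
  · have hmod' : (m - 1) % p = m % p - 1 := by
      have : m - 1 = m % p - 1 + p * (m / p) := by omega
      rw [this, Nat.add_mul_mod_self_left, Nat.mod_eq_of_lt (by omega)]
    have hm' : ¬ p ∣ m - 1 := fun hdvd => by
      have := Nat.mod_eq_zero_of_dvd hdvd
      omega
    rw [hR', padicValNat_pow_mul_of_not_dvd hp f hm', pDigit_pow_mul hp.pos, hmod']
    calc r + p ^ f < 2 * (p - m % p) * p ^ f + 2 * p ^ f := by omega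
      _ = 2 * (p - m % p + 1) * p ^ f := by ring
      _ = 2 * (p - (m % p - 1)) * p ^ f := by
        rw [show p - (m % p - 1) = p - m % p + 1 by omega]
end

section
/- Let p be a prime and N ≥ 2 an integer. For every t ≥ 0 such that the base-p digit N_t of N at position t is nonzero, and for every integer d with 0 ≤ d ≤ N_t - 1, the number (N mod p^t) + d·p^t belongs to I_p(N). (In the notation N = Σ_{i=1}^{h} N_i p^{s_i} with nonzero digits N_i at positions s_1 < … < s_h, this says Σ_{i=1}^{j} N_i p^{s_i} + d·p^{s_{j+1}} ∈ I_p(N) for 0 ≤ j ≤ h-1 and 0 ≤ d ≤ N_{j+1} - 1.) -/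
/-- Let `p` be a prime and `N ≥ 2`. For every position `t` at which the base-`p` digit `N_t`
of `N` is nonzero and every `d` with `0 ≤ d ≤ N_t - 1`, the number `(N mod p^t) + d·p^t`
belongs to `I_p(N)`.  (These are the partial sums `Σ_{i=1}^{j} N_i p^{s_i} + d·p^{s_{j+1}}`.) -/
theorem partial_sum_mem_IpSet (p N t d : ℕ) (hp : p.Prime) (hN : 2 ≤ N)
    (ht : pDigit p N t ≠ 0) (hd : d ≤ pDigit p N t - 1) :
    N % p ^ t + d * p ^ t ∈ IpSet p N := by
  have : Fact p.Prime := ⟨hp⟩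
  have hP : 0 < p ^ t := pow_pos hp.pos t
  unfold pDigit at ht hd
  set q := N / p ^ t with hq
  have hN' : p ^ t * q + N % p ^ t = N := Nat.div_add_mod N (p ^ t)
  have hm : N % p ^ t < p ^ t := Nat.mod_lt _ hP
  have hlt : q % p < p := Nat.mod_lt _ hp.pos
  have hdq : d < q := by have := Nat.mod_le q p; omega
  have hR : N - (N % p ^ t + d * p ^ t) = p ^ t * (q - d) := by
    rw [Nat.mul_sub, mul_comm d]; omega
  have hmod : (q - d) % p = q % p - d := by
    have hsplit : q - d = q % p - d + p * (q / p) := by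
      have := Nat.div_add_mod q p; omega
    rw [hsplit, Nat.add_mul_mod_self_left, Nat.mod_eq_of_lt (by omega)]
  have hval : padicValNat p (p ^ t * (q - d)) = t := by
    have hndvd : ¬ p ∣ q - d := by
      rw [Nat.dvd_iff_mod_eq_zero]; omega
    rw [padicValNat.mul hP.ne' (by omega), padicValNat.prime_pow,
      padicValNat.eq_zero_of_not_dvd hndvd, add_zero]
  have hRpos : 0 < p ^ t * (q - d) := Nat.mul_pos hP (by omega)
  unfold IpSet pDigit
  rw [Finset.mem_filter, Finset.mem_range, hR, hval, Nat.mul_div_cancel_left _ hP, hmod]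
  refine ⟨by omega, ?_⟩
  calc N % p ^ t + d * p ^ t < (d + 1) * p ^ t := by rw [add_mul]; omega
    _ ≤ 2 * (p - (q % p - d)) * p ^ t := Nat.mul_le_mul_right _ (by omega)
end

section
/- Let p be a prime and N ≥ 2 an integer. Then I_p(N) = {0, 1, …, N-1} (equivalently C_p(N) = N) if and only if p ≥ N. (Representation-theoretically: all Weyl modules of Sp(2m) with fundamental or zero highest weight are simple if and only if p ≥ m+1, where N = m+1.) -/
/-- Below `p`, a positive integer has valuation zero and is its own lowest digit. -/
theorem mem_IpSet_of_sub_lt {p N r : ℕ} (hr : r < N) (h : N - r < p) :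
    r ∈ IpSet p N ↔ r < 2 * (p - (N - r)) := by
  have hv : padicValNat p (N - r) = 0 :=
    padicValNat.eq_zero_of_not_dvd (Nat.not_dvd_of_pos_of_lt (by omega) h)
  rw [IpSet, Finset.mem_filter]
  simp [hv, pDigit, hr, Nat.mod_eq_of_lt h]

/-- Let `p` be a prime and `N ≥ 2`.  Then `I_p(N) = {0, 1, …, N-1}` (equivalently
`C_p(N) = N`) if and only if `p ≥ N`. -/
theorem IpSet_eq_range_iff (p N : ℕ) (hp : p.Prime) (hN : 2 ≤ N) :
    IpSet p N = Finset.range N ↔ N ≤ p := by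
  have hp2 := hp.two_le
  constructor
  · intro h
    by_contra! hlt
    have hmem : N - (p - 1) ∈ IpSet p N := h ▸ Finset.mem_range.2 (by omega)
    rw [mem_IpSet_of_sub_lt (by omega) (by omega)] at hmem
    omega
  · intro hle
    refine Finset.Subset.antisymm (Finset.filter_subset _ _) fun r hr => ?_
    have hrN := Finset.mem_range.1 hr
    rcases lt_or_ge (N - r) p with h | h
    · rw [mem_IpSet_of_sub_lt hrN h]
      omega
    · obtain rfl : r = 0 := by omega
      obtain rfl : N = p := by omega
      have : Fact N.Prime := ⟨hp⟩
      rw [IpSet, Finset.mem_filter]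
      simp [pDigit, Nat.div_self hp.pos, Nat.mod_eq_of_lt hp.one_lt, hp.pos, hp.one_lt]
end

section
/- Let p be a prime and let r, m be integers with 1 ≤ r ≤ m. Set R = m+1-r, let f be the p-adic valuation of R and let R_f be the base-p digit of R at position f. The following are equivalent: (1) r < 2(p - R_f)·p^f; (2) for every integer j with 1 ≤ j ≤ r/2, one has v_p(R + j) ≤ v_p(j), where v_p denotes the p-adic valuation; (3) for every integer j with 1 ≤ j ≤ ⌊r/2⌋, p does not divide the binomial coefficient C(R + j, j). -/
/-- Every `R + j` with `1 ≤ j ≤ r / 2` has valuation at most that of `j` iff `r / 2` is below the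
distance from `R` to the next multiple of `p ^ (v_p(R) + 1)`. -/
theorem lt_iff_forall_padicValNat_add_le {p R : ℕ} (hp : p.Prime) (hR : R ≠ 0) (r : ℕ) :
    r < 2 * (p - pDigit p R (padicValNat p R)) * p ^ padicValNat p R ↔
      ∀ j, 1 ≤ j → 2 * j ≤ r → padicValNat p (R + j) ≤ padicValNat p j := by
  have := Fact.mk hp
  obtain ⟨u, hu⟩ : p ^ padicValNat p R ∣ R := pow_padicValNat_dvd
  have hndvd : ¬ p ^ (padicValNat p R + 1) ∣ R := pow_succ_padicValNat_not_dvd hR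
  generalize padicValNat p R = f at *
  subst hu
  have hf : 0 < p ^ f := pow_pos hp.pos f
  have hpu : ¬ p ∣ u := fun h ↦ hndvd (by rw [pow_succ]; exact mul_dvd_mul_left _ h)
  have hdigit : pDigit p (p ^ f * u) f = u % p := by
    rw [pDigit, Nat.mul_div_cancel_left _ hf]
  have hd0 : u % p ≠ 0 := fun h ↦ hpu (Nat.dvd_of_mod_eq_zero h)
  have hdp : u % p < p := Nat.mod_lt _ hp.pos
  rw [hdigit]
  constructor
  · intro h j hj hjr
    rcases le_or_gt (padicValNat p (p ^ f * u + j)) f with hv | hv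
    · refine (padicValNat_dvd_iff_le (by lia)).1 ?_
      exact (Nat.dvd_add_right ((pow_dvd_pow p hv).mul_right u)).1 pow_padicValNat_dvd
    · exfalso
      have hdvd : p ^ (f + 1) ∣ p ^ f * u + j := (pow_dvd_pow p hv).trans pow_padicValNat_dvd
      obtain ⟨k, rfl⟩ : p ^ f ∣ j :=
        (Nat.dvd_add_right (dvd_mul_right _ u)).1 ((pow_dvd_pow p f.le_succ).trans hdvd)
      rw [← mul_add, pow_succ] at hdvd
      have hdvd' : p ∣ u + k := Nat.dvd_of_mul_dvd_mul_left hf hdvd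
      have hk : k < p - u % p := by
        by_contra! hk
        have := Nat.mul_le_mul_left (p ^ f) hk
        nlinarith
      have hk0 : k ≠ 0 := by
        rintro rfl
        simp at hj
      have hmod : p ∣ u % p + k := by
        rw [Nat.dvd_iff_mod_eq_zero] at hdvd' ⊢
        simpa using hdvd'
      have := Nat.le_of_dvd (by lia) hmod
      lia
  · intro h
    by_contra! hr
    have hpos : 0 < p - u % p := by lia
    have hK : 0 < p ^ f * (p - u % p) := Nat.mul_pos hf hpos
    have hle := h (p ^ f * (p - u % p)) hK (by linarith)
    have hval : padicValNat p (p ^ f * (p - u % p)) = f := by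
      rw [padicValNat.mul hf.ne' hpos.ne', padicValNat.prime_pow,
        padicValNat.eq_zero_of_not_dvd (Nat.not_dvd_of_pos_of_lt hpos (by lia)), add_zero]
    have hdvd : p ^ (f + 1) ∣ p ^ f * u + p ^ f * (p - u % p) := by
      rw [← mul_add, pow_succ]
      refine mul_dvd_mul_left _ ⟨u / p + 1, ?_⟩
      have := Nat.div_add_mod u p
      rw [mul_add]
      lia
    have := (padicValNat_dvd_iff_le (by lia)).1 hdvd
    lia

theorem padicValNat_add_choose_succ {p : ℕ} [Fact p.Prime] (R j : ℕ) :
    padicValNat p ((R + (j + 1)).choose (j + 1)) + padicValNat p (j + 1) =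
      padicValNat p (R + (j + 1)) + padicValNat p ((R + j).choose j) := by
  rw [← padicValNat.mul (Nat.choose_pos (by lia)).ne' (by lia),
    ← padicValNat.mul (by lia) (Nat.choose_pos (by lia)).ne']
  exact congrArg _ (Nat.add_one_mul_choose_eq (R + j) j).symm

theorem forall_padicValNat_add_le_iff_forall_not_dvd_choose {p : ℕ} (hp : p.Prime) (R r : ℕ) :
    (∀ j, 1 ≤ j → 2 * j ≤ r → padicValNat p (R + j) ≤ padicValNat p j) ↔
      ∀ j, 1 ≤ j → 2 * j ≤ r → ¬ p ∣ (R + j).choose j := by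
  have := Fact.mk hp
  constructor
  · intro h j _ hjr
    induction j with
    | zero => simpa using hp.ne_one
    | succ j ih =>
      have hprev : ¬ p ∣ (R + j).choose j := by
        rcases Nat.eq_zero_or_pos j with rfl | hj
        · simpa using hp.ne_one
        · exact ih hj (by lia)
      intro hdvd
      have hpos := one_le_padicValNat_of_dvd (Nat.choose_pos (by lia)).ne' hdvd
      have hrec := padicValNat_add_choose_succ (p := p) R j
      have hle := h (j + 1) (by lia) hjr
      rw [padicValNat.eq_zero_of_not_dvd hprev] at hrec
      lia
  · intro h j hj hjr
    obtain ⟨j, rfl⟩ := Nat.exists_eq_add_of_le' hj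
    have hrec := padicValNat_add_choose_succ (p := p) R j
    rw [padicValNat.eq_zero_of_not_dvd (h _ hj hjr)] at hrec
    lia


/-- Let `p` be a prime and `1 ≤ r ≤ m`.  With `R = m+1-r`, `f` the `p`-adic valuation of `R`
and `R_f` the digit of `R` at position `f`, the following are equivalent:
(1) `r < 2(p - R_f)·p^f`;
(2) for every `1 ≤ j ≤ r/2`, `v_p(R + j) ≤ v_p(j)`;
(3) for every `1 ≤ j ≤ ⌊r/2⌋`, `p` does not divide `C(R + j, j)`. -/
theorem weyl_simple_criteria (p r m : ℕ) (hp : p.Prime) (hr : 1 ≤ r) (hm : r ≤ m) :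
    ((r < 2 * (p - pDigit p (m + 1 - r) (padicValNat p (m + 1 - r))) *
        p ^ padicValNat p (m + 1 - r)) ↔
      (∀ j, 1 ≤ j → 2 * j ≤ r → padicValNat p (m + 1 - r + j) ≤ padicValNat p j)) ∧
    ((r < 2 * (p - pDigit p (m + 1 - r) (padicValNat p (m + 1 - r))) *
        p ^ padicValNat p (m + 1 - r)) ↔
      (∀ j, 1 ≤ j → 2 * j ≤ r → ¬ p ∣ Nat.choose (m + 1 - r + j) j)) := by
  have h := lt_iff_forall_padicValNat_add_le hp (R := m + 1 - r) (by lia) r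
  exact ⟨h, h.trans (forall_padicValNat_add_le_iff_forall_not_dvd_choose hp _ r)⟩
end

section
/- Let p be a prime, n ≥ 0 an integer, and let u, v be integers with 1 ≤ u ≤ v ≤ p^{n+1}, v - u even, and (v-u)/2 ≺ u. If v = d·p^n for some 1 ≤ d ≤ p, or u = d·p^n for some 1 ≤ d ≤ p, then u = v. -/
/-- `a ≺ b` : `a ≺₁ b` or `a ≺₋₁ b`. -/
def Prec (p a b : ℕ) : Prop := PrecOne p a b ∨ PrecNegOne p a b

/-- `a ≺_k b` for a sign `k ∈ {1, -1}` : `a ≺₁ b` when `k = 1`, and `a ≺₋₁ b` when `k = -1`. -/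
def PrecK (p : ℕ) (k : ℤ) (a b : ℕ) : Prop :=
  if k = 1 then PrecOne p a b else PrecNegOne p a b

theorem pow_dvd_of_pDigit_eq_zero {p a k : ℕ} (h : ∀ i < k, pDigit p a i = 0) : p ^ k ∣ a := by
  induction k with
  | zero => simp
  | succ k ih =>
    have hk := ih fun i hi => h i (by omega)
    rw [pow_succ]
    exact Nat.mul_dvd_of_dvd_div hk (Nat.dvd_of_mod_eq_zero (h k (by omega)))

/-- If `a ≺ b` with `b = p ^ s * m` and `p ∤ m`, then `a = p ^ s * c` where `p` divides `c` or
`c + m`. -/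
theorem Prec.exists_factorization {p a b : ℕ} (hp : p.Prime) (hb : b ≠ 0) (h : Prec p a b) :
    ∃ s c m, b = p ^ s * m ∧ ¬ p ∣ m ∧ a = p ^ s * c ∧ (p ∣ c ∨ p ∣ c + m) := by
  have : Fact p.Prime := ⟨hp⟩
  obtain ⟨m, hm⟩ := pow_padicValNat_dvd (p := p) (n := b)
  have hlow : ∀ i < padicValNat p b, pDigit p a i = 0 := by
    rcases h with h | h
    · exact fun i hi => h.1 i hi.le
    · exact h.1
  obtain ⟨c, hc⟩ := pow_dvd_of_pDigit_eq_zero hlow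
  have hpos : 0 < p ^ padicValNat p b := pow_pos hp.pos _
  refine ⟨padicValNat p b, c, m, hm, fun hd => ?_, hc, ?_⟩
  · apply pow_succ_padicValNat_not_dvd (p := p) hb
    nth_rewrite 2 [hm]
    rw [pow_succ]
    exact Nat.mul_dvd_mul_left _ hd
  · have hac : a / p ^ padicValNat p b = c := Nat.div_eq_of_eq_mul_right hpos hc
    have hbm : b / p ^ padicValNat p b = m := Nat.div_eq_of_eq_mul_right hpos hm
    rcases h with h | h
    · left
      have h0 := h.1 _ le_rfl
      rw [pDigit, hac] at h0
      exact Nat.dvd_of_mod_eq_zero h0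
    · right
      have h0 := h.2.1
      rw [pDigit, pDigit, hac, hbm] at h0
      apply Nat.dvd_of_mod_eq_zero
      rw [Nat.add_mod, h0, Nat.mod_self]

/-- Let `p` be prime, `n ≥ 0`, and let `1 ≤ u ≤ v ≤ p^{n+1}` with `v - u` even and
`(v-u)/2 ≺ u`.  If `v = d·p^n` or `u = d·p^n` for some `1 ≤ d ≤ p`, then `u = v`. -/
theorem eq_of_prec_of_multiple (p n u v : ℕ) (hp : p.Prime) (hu : 1 ≤ u) (huv : u ≤ v)
    (hv : v ≤ p ^ (n + 1)) (he : 2 ∣ v - u) (hprec : Prec p ((v - u) / 2) u)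
    (h : (∃ d, 1 ≤ d ∧ d ≤ p ∧ v = d * p ^ n) ∨ (∃ d, 1 ≤ d ∧ d ≤ p ∧ u = d * p ^ n)) :
    u = v := by
  obtain ⟨a, ha⟩ := he
  have hva : v = u + 2 * a := by omega
  rw [show (v - u) / 2 = a by omega] at hprec
  obtain ⟨s, c, m, hum, hpm, hac, hcm⟩ := hprec.exists_factorization hp (by omega)
  have hpos : 0 < p ^ s := pow_pos hp.pos _
  have hns : n ≤ s := by
    by_contra! hlt
    have hdvd : p ^ (s + 1) ∣ p ^ n := pow_dvd_pow p hlt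
    rcases h with ⟨d, -, -, hd⟩ | ⟨d, -, -, hd⟩
    · have hv' : p ^ s * p ∣ p ^ s * (m + 2 * c) := by
        rw [← pow_succ, show p ^ s * (m + 2 * c) = v by rw [hva, hum, hac]; ring, hd]
        exact hdvd.mul_left d
      have hmc := Nat.dvd_of_mul_dvd_mul_left hpos hv'
      apply hpm
      rcases hcm with hc | hc
      · exact (Nat.dvd_add_left (hc.mul_left 2)).1 hmc
      · refine (Nat.dvd_add_right hmc).1 ?_
        rw [show m + 2 * c + m = 2 * (c + m) by ring]
        exact hc.mul_left 2
    · have hu' : p ^ s * p ∣ p ^ s * m := by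
        rw [← pow_succ, ← hum, hd]
        exact hdvd.mul_left d
      exact hpm (Nat.dvd_of_mul_dvd_mul_left hpos hu')
  have hle : p ^ (n + 1) ≤ p ^ s * p := by
    rw [← pow_succ]
    exact Nat.pow_le_pow_right hp.pos (by omega)
  rcases hcm with hc | hc
  · have hdvd : p ^ s * p ∣ a := hac ▸ Nat.mul_dvd_mul_left _ hc
    have := Nat.eq_zero_of_dvd_of_lt hdvd (by omega)
    omega
  · have hm0 : m ≠ 0 := by rintro rfl; simp at hpm
    have := Nat.mul_le_mul_left (p ^ s) (Nat.le_of_dvd (by omega) hc)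
    rw [mul_add, ← hac, ← hum] at this
    omega
end

section
/- Let p be a prime and n ≥ 0 an integer. For all integers u', v' with 1 ≤ u' ≤ v' ≤ p^{n+1} and v' - u' even, the relation (v'-u')/2 ⊂ v' holds if and only if one of the following holds: (1) there exist integers d, u, v with 0 ≤ d ≤ p-1, 1 ≤ u ≤ v ≤ p^n, v - u even, (v-u)/2 ⊂ v, u' = d·p^n + u and v' = d·p^n + v; or (2) there exist integers d, u, v with 1 ≤ d ≤ p-1, 1 ≤ u ≤ v ≤ p^n, u ≤ p^n - 1, v - u even, (v-u)/2 ⊂ v, u' = d·p^n - u and v' = d·p^n + v. (This is the block-recursive description of the decomposition matrices B(p^{n+1}) in terms of B(p^n).) -/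
theorem pDigit_index_zero (p a : ℕ) : pDigit p a 0 = a % p := by
  simp [pDigit]

theorem pDigit_succ (p a i : ℕ) : pDigit p a (i + 1) = pDigit p (a / p) i := by
  simp [pDigit, pow_succ', Nat.div_div_eq_div_mul]

theorem pDigit_eq_zero_of_lt {p a n i : ℕ} (hp : 0 < p) (ha : a < p ^ n) (hi : n ≤ i) :
    pDigit p a i = 0 := by
  rw [pDigit, Nat.div_eq_of_lt (ha.trans_le (Nat.pow_le_pow_right hp hi)), Nat.zero_mod]

theorem pDigit_mul_pow_add {p n i : ℕ} (hp : 0 < p) (hi : i < n) (d v : ℕ) :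
    pDigit p (d * p ^ n + v) i = pDigit p v i := by
  obtain ⟨k, rfl⟩ := Nat.exists_eq_add_of_lt hi
  have h : d * p ^ (i + k + 1) + v = v + p ^ i * (p * (d * p ^ k)) := by ring
  rw [pDigit, pDigit, h, Nat.add_mul_div_left _ _ (by positivity), Nat.add_mul_mod_self_left]

theorem psub_iff_mod_div (p a b : ℕ) :
    PSub p a b ↔ (a % p = 0 ∨ a % p = b % p) ∧ PSub p (a / p) (b / p) := by
  constructor
  · intro h
    refine ⟨by simpa only [pDigit_index_zero] using h 0, fun i => ?_⟩
    simpa only [pDigit_succ] using h (i + 1)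
  · rintro ⟨h, h'⟩ (_ | i)
    · simpa only [pDigit_index_zero] using h
    · simpa only [pDigit_succ] using h' i

theorem PSub.refl (p a : ℕ) : PSub p a a := fun _ => Or.inr rfl

/-- The complement of `a ⊂ b` in `b`: the subtraction `b - a` involves no borrowing. -/
theorem PSub.le_and_sub {p : ℕ} (hp : 1 < p) {a b : ℕ} (h : PSub p a b) :
    a ≤ b ∧ PSub p (b - a) b := by
  induction a using Nat.strong_induction_on generalizing b with
  | _ a ih =>
    rcases Nat.eq_zero_or_pos a with rfl | ha
    · exact ⟨Nat.zero_le _, by simpa using PSub.refl p b⟩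
    obtain ⟨h0, h1⟩ := (psub_iff_mod_div p a b).1 h
    obtain ⟨hle, hs⟩ := ih _ (Nat.div_lt_self ha hp) h1
    have hmod : a % p ≤ b % p := by omega
    have hb : b % p < p := Nat.mod_lt _ (by omega)
    obtain ⟨k, hk⟩ := Nat.exists_eq_add_of_le hle
    have ea := Nat.mod_add_div a p
    have eb := Nat.mod_add_div b p
    rw [hk, mul_add] at eb
    have hsub : b - a = (b % p - a % p) + p * k := by omega
    refine ⟨by omega, (psub_iff_mod_div p _ b).2 ?_⟩
    have hm : (b - a) % p = b % p - a % p := by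
      rw [hsub, Nat.add_mul_mod_self_left, Nat.mod_eq_of_lt (by omega)]
    have hd : (b - a) / p = b / p - a / p := by
      rw [hsub, Nat.add_mul_div_left _ _ (by omega), Nat.div_eq_of_lt (by omega)]
      omega
    rw [hm, hd]
    exact ⟨by omega, hs⟩

theorem psub_mul_pow_add_iff {p n a : ℕ} (hp : 0 < p) (ha : a < p ^ n) (d v : ℕ) :
    PSub p a (d * p ^ n + v) ↔ PSub p a v := by
  refine forall_congr' fun i => ?_
  rcases lt_or_ge i n with hi | hi
  · rw [pDigit_mul_pow_add hp hi]
  · simp [pDigit_eq_zero_of_lt hp ha hi]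

theorem eq_zero_of_psub_two_mul {p : ℕ} (hp : 1 < p) {a : ℕ} (h : PSub p a (2 * a)) : a = 0 := by
  by_contra ha
  obtain ⟨s, m, hm, rfl⟩ := Nat.exists_eq_pow_mul_and_not_dvd ha p (by omega)
  have hs := h s
  have hpos : 0 < p ^ s := by positivity
  rw [pDigit, pDigit, mul_left_comm, Nat.mul_div_cancel_left _ hpos,
    Nat.mul_div_cancel_left _ hpos] at hs
  rcases hs with hs | hs
  · exact hm (Nat.dvd_of_mod_eq_zero hs)
  · have := (Nat.modEq_iff_dvd' (by omega : m ≤ 2 * m)).1 hs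
    exact hm (by simpa [two_mul] using this)

/-- If `a ⊂ b` and `2 * a < b ≤ p ^ (n + 1)`, then the digit of `a` at `n` vanishes. -/
theorem PSub.lt_pow {p n a b : ℕ} (hp : 0 < p) (h : PSub p a b) (hab : 2 * a < b)
    (hb : b ≤ p ^ (n + 1)) : a < p ^ n := by
  by_contra! hn
  have hq : 0 < p ^ n := by positivity
  have ha1 : 1 ≤ a / p ^ n := (Nat.one_le_div_iff hq).2 hn
  have hlt : a / p ^ n < p := by
    rw [Nat.div_lt_iff_lt_mul hq, ← pow_succ']
    omega
  have h2 : 2 * (a / p ^ n) ≤ b / p ^ n := by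
    rw [Nat.le_div_iff_mul_le hq]
    have := Nat.div_mul_le_self a (p ^ n)
    rw [mul_assoc]
    omega
  have hbp : b / p ^ n ≤ p := Nat.div_le_of_le_mul (by rwa [← pow_succ])
  have hd := h n
  rw [pDigit, pDigit, Nat.mod_eq_of_lt hlt] at hd
  rcases hbp.eq_or_lt with hbp | hbp
  · rw [hbp, Nat.mod_self] at hd
    omega
  · rw [Nat.mod_eq_of_lt hbp] at hd
    omega

/-- Block-recursive description of the matrices `B(p^{n+1})` in terms of `B(p^n)`.  For a
prime `p`, `n ≥ 0`, and `1 ≤ u' ≤ v' ≤ p^{n+1}` with `v' - u'` even, one has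
`(v'-u')/2 ⊂ v'` if and only if either
(1) `u' = d·p^n + u`, `v' = d·p^n + v` with `0 ≤ d ≤ p-1`, `1 ≤ u ≤ v ≤ p^n`, `v - u` even
and `(v-u)/2 ⊂ v`, or
(2) `u' = d·p^n - u`, `v' = d·p^n + v` with `1 ≤ d ≤ p-1`, `1 ≤ u ≤ v ≤ p^n`, `u ≤ p^n - 1`,
`v - u` even and `(v-u)/2 ⊂ v`. -/
theorem psub_block_recursion (p n : ℕ) (hp : p.Prime) (u' v' : ℕ)
    (hu' : 1 ≤ u') (huv' : u' ≤ v') (hv' : v' ≤ p ^ (n + 1)) (he : 2 ∣ v' - u') :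
    PSub p ((v' - u') / 2) v' ↔
      (∃ d u v, d ≤ p - 1 ∧ 1 ≤ u ∧ u ≤ v ∧ v ≤ p ^ n ∧ 2 ∣ v - u ∧
        PSub p ((v - u) / 2) v ∧ u' = d * p ^ n + u ∧ v' = d * p ^ n + v) ∨
      (∃ d u v, 1 ≤ d ∧ d ≤ p - 1 ∧ 1 ≤ u ∧ u ≤ v ∧ v ≤ p ^ n ∧ u ≤ p ^ n - 1 ∧ 2 ∣ v - u ∧
        PSub p ((v - u) / 2) v ∧ u' = d * p ^ n - u ∧ v' = d * p ^ n + v) := by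
  have hp1 := hp.one_lt
  have hq : 0 < p ^ n := Nat.pow_pos hp.pos
  constructor
  · intro h
    obtain ⟨a, ha⟩ := he
    rw [ha, Nat.mul_div_cancel_left _ two_pos] at h
    have haq : a < p ^ n := h.lt_pow hp.pos (by omega) hv'
    obtain ⟨d, v, hv1, hvq, rfl⟩ : ∃ d v, 1 ≤ v ∧ v ≤ p ^ n ∧ v' = d * p ^ n + v := by
      refine ⟨(v' - 1) / p ^ n, (v' - 1) % p ^ n + 1, Nat.le_add_left _ _, Nat.mod_lt _ hq, ?_⟩
      have := Nat.div_add_mod' (v' - 1) (p ^ n)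
      omega
    have hd : d ≤ p - 1 := by
      have : d < p := by
        by_contra! hd
        have := Nat.mul_le_mul_right (p ^ n) hd
        rw [pow_succ'] at hv'
        omega
      omega
    rw [psub_mul_pow_add_iff hp.pos haq] at h
    obtain ⟨hav, hc⟩ := h.le_and_sub hp1
    rcases lt_trichotomy v (2 * a) with hlt | rfl | hlt
    · refine Or.inr ⟨d, 2 * a - v, v, ?_, hd, by omega, by omega, hvq, by omega, by omega, ?_,
        by omega, rfl⟩
      · rcases Nat.eq_zero_or_pos d with rfl | h0 <;> omega
      · rwa [show (v - (2 * a - v)) / 2 = v - a by omega]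
    · have := eq_zero_of_psub_two_mul hp1 h
      omega
    · refine Or.inl ⟨d, v - 2 * a, v, hd, by omega, by omega, hvq, by omega, ?_, by omega, rfl⟩
      rwa [show (v - (v - 2 * a)) / 2 = a by omega]
  · rintro (⟨d, u, v, hd, hu, huv, hv, h2, h, rfl, rfl⟩ |
      ⟨d, u, v, hd1, hd, hu, huv, hv, huq, h2, h, rfl, rfl⟩)
    · rwa [Nat.add_sub_add_left, psub_mul_pow_add_iff hp.pos (by omega)]
    · have hc := (h.le_and_sub hp1).2
      have := Nat.le_mul_of_pos_left (p ^ n) hd1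
      rw [show (d * p ^ n + v - (d * p ^ n - u)) / 2 = v - (v - u) / 2 by omega,
        psub_mul_pow_add_iff hp.pos (by omega)]
      exact hc
end
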